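/- arXiv:1010.1029 — 5 statements merged into one kernel-verified Lean document; each statement's English description precedes it below -/
import Mathlib

section
/- For every n ∈ ℕ, every A ∈ σ(𝒜ⁿ) and every k ∈ ℕ one has μ(A ∩ T^{−k}A) ≤ μ(A)·δ_A(k). -/
open MeasureTheory Filter Set

/-- `A` is an `n`-cylinder for the map `T` and the partition `𝒜`:
an element of the join `⋁_{j=0}^{n-1} T^{-j}𝒜`. -/
def IsCylinder {Ω : Type*} (T : Ω → Ω) (𝒜 : Set (Set Ω)) (n : ℕ) (A : Set Ω) : Prop :=
  ∃ f : ℕ → Set Ω, (∀ j < n, f j ∈ 𝒜) ∧ A = ⋂ j ∈ Finset.range n, T^[j] ⁻¹' f j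

/-- `A` is a countable union of `n`-cylinders, i.e. `A ∈ σ(𝒜ⁿ)`. -/
def IsCylinderUnion {Ω : Type*} (T : Ω → Ω) (𝒜 : Set (Set Ω)) (n : ℕ) (A : Set Ω) : Prop :=
  ∃ 𝒞 : Set (Set Ω), 𝒞.Countable ∧ (∀ C ∈ 𝒞, IsCylinder T 𝒜 n C) ∧ A = ⋃₀ 𝒞

/-- The σ-algebra generated by all cylinders `⋃_ℓ 𝒜^ℓ`. -/
def cylinderSigma {Ω : Type*} (T : Ω → Ω) (𝒜 : Set (Set Ω)) : MeasurableSpace Ω :=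
  MeasurableSpace.generateFrom {S | ∃ ℓ, IsCylinder T 𝒜 ℓ S}

/-- `μ` is α-mixing for `T` with respect to the partition `𝒜`:
`|μ(A ∩ T^{-n-k}B) − μ(A)μ(B)| ≤ α(k) μ(B)` for every union `A` of `n`-cylinders and every
`B` in the σ-algebra generated by all cylinders. -/
def AlphaMixing {Ω : Type*} [MeasurableSpace Ω] (μ : Measure Ω) (T : Ω → Ω)
    (𝒜 : Set (Set Ω)) (α : ℕ → ℝ) : Prop :=
  ∀ n k : ℕ, ∀ A B : Set Ω, IsCylinderUnion T 𝒜 n A →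
    MeasurableSet[cylinderSigma T 𝒜] B →
    |(μ (A ∩ T^[n + k] ⁻¹' B)).toReal - (μ A).toReal * (μ B).toReal| ≤ α k * (μ B).toReal

/-- `A^{(w)}`: the smallest union of `w`-cylinders containing `A`. -/
def cylinderHull {Ω : Type*} (T : Ω → Ω) (𝒜 : Set (Set Ω)) (w : ℕ) (A : Set Ω) : Set Ω :=
  ⋃₀ {C | IsCylinder T 𝒜 w C ∧ (C ∩ A).Nonempty}

/-- `δ_A(k) = min_{1 ≤ w ≤ k} ( μ(A^{(w)}) + α(k−w) )`. -/
noncomputable def deltaA {Ω : Type*} [MeasurableSpace Ω] (μ : Measure Ω) (T : Ω → Ω)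
    (𝒜 : Set (Set Ω)) (α : ℕ → ℝ) (A : Set Ω) (k : ℕ) : ℝ :=
  sInf ((fun w => (μ (cylinderHull T 𝒜 w A)).toReal + α (k - w)) '' Set.Icc 1 k)

/-- `ᾱ(n) = Σ_{j=n}^∞ α(j)`. -/
noncomputable def alphaBar (α : ℕ → ℝ) (n : ℕ) : ℝ := ∑' j : ℕ, α (n + j)

/-- The hitting time `τ_A(x) = inf {k ≥ 1 : T^k x ∈ A}` (with value `⊤` if the orbit
never enters `A`). -/
noncomputable def hitTime {Ω : Type*} (T : Ω → Ω) (A : Set Ω) (x : Ω) : ℕ∞ :=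
  sInf {ℓ : ℕ∞ | ∃ m : ℕ, ℓ = (m : ℕ∞) ∧ 1 ≤ m ∧ T^[m] x ∈ A}

/-- The `k`-th hitting time `τ_A^k`. -/
noncomputable def hitTimeK {Ω : Type*} (T : Ω → Ω) (A : Set Ω) : ℕ → Ω → ℕ∞
  | 0, _ => 0
  | k + 1, x =>
      sInf {ℓ : ℕ∞ | ∃ m : ℕ, ℓ = (m : ℕ∞) ∧ hitTimeK T A k x < (m : ℕ∞) ∧ T^[m] x ∈ A}

/-- The recurrence time `r_A = inf {j ≥ 1 : A ∩ T^{-j}A ≠ ∅}`. -/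
noncomputable def recTime {Ω : Type*} (T : Ω → Ω) (A : Set Ω) : ℕ :=
  sInf {j : ℕ | 1 ≤ j ∧ (A ∩ T^[j] ⁻¹' A).Nonempty}

/-- `W_m(x) = Σ_{j=1}^m 1_A(T^j x)`, the number of visits to `A` up to time `m`. -/
noncomputable def visits {Ω : Type*} (T : Ω → Ω) (A : Set Ω) (m : ℕ) (x : Ω) : ℕ :=
  ∑ j ∈ Finset.Icc 1 m, A.indicator (fun _ => 1) (T^[j] x)

/-- `W_m^i(x) = Σ_{1 ≤ j ≤ m, j ≠ i} 1_A(T^j x)`. -/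
noncomputable def visitsAvoid {Ω : Type*} (T : Ω → Ω) (A : Set Ω) (m i : ℕ) (x : Ω) : ℕ :=
  ∑ j ∈ (Finset.Icc 1 m).erase i, A.indicator (fun _ => 1) (T^[j] x)

theorem countable_cylinders {Ω : Type*} (T : Ω → Ω) (𝒜 : Set (Set Ω)) (hcnt : 𝒜.Countable)
    (w : ℕ) : {C | IsCylinder T 𝒜 w C}.Countable := by
  haveI : Countable 𝒜 := hcnt.to_subtype
  refine (Set.countable_range
    (fun g : Fin w → 𝒜 => ⋂ j : Fin w, T^[(j : ℕ)] ⁻¹' (g j : Set Ω))).mono ?_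
  rintro C ⟨f, hf, rfl⟩
  refine ⟨fun j => ⟨f j, hf j j.2⟩, ?_⟩
  ext x
  simp only [Set.mem_iInter, Set.mem_preimage, Finset.mem_range]
  exact ⟨fun h i hi => h ⟨i, hi⟩, fun h i => h i i.2⟩

theorem isCylinderUnion_hull {Ω : Type*} (T : Ω → Ω) (𝒜 : Set (Set Ω)) (hcnt : 𝒜.Countable)
    (w : ℕ) (A : Set Ω) : IsCylinderUnion T 𝒜 w (cylinderHull T 𝒜 w A) :=
  ⟨_, (countable_cylinders T 𝒜 hcnt w).mono (fun _ hC => hC.1), fun _ hC => hC.1, rfl⟩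

theorem subset_hull {Ω : Type*} (T : Ω → Ω) (𝒜 : Set (Set Ω)) (hcov : ⋃₀ 𝒜 = Set.univ)
    (w : ℕ) (A : Set Ω) : A ⊆ cylinderHull T 𝒜 w A := by
  intro x hx
  have h : ∀ j : ℕ, ∃ s ∈ 𝒜, T^[j] x ∈ s := fun j => by
    have : T^[j] x ∈ ⋃₀ 𝒜 := hcov ▸ Set.mem_univ _
    exact this
  choose f hf hxf using h
  have hxC : x ∈ ⋂ j ∈ Finset.range w, T^[j] ⁻¹' f j := by
    simp only [Set.mem_iInter, Set.mem_preimage]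
    exact fun i _ => hxf i
  exact ⟨_, ⟨⟨f, fun j _ => hf j, rfl⟩, ⟨x, hxC, hx⟩⟩, hxC⟩

/-- For every `n ∈ ℕ`, every `A ∈ σ(𝒜ⁿ)` and every `k ∈ ℕ` one has
`μ(A ∩ T^{−k}A) ≤ μ(A)·δ_A(k)`. -/
theorem measure_inter_preimage_le_deltaA
    {Ω : Type*} [MeasurableSpace Ω] (μ : Measure Ω) [IsProbabilityMeasure μ]
    (T : Ω → Ω) (hT : MeasurePreserving T μ μ)
    (𝒜 : Set (Set Ω)) (hcnt : 𝒜.Countable) (hms : ∀ s ∈ 𝒜, MeasurableSet s)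
    (hdisj : 𝒜.PairwiseDisjoint id) (hcov : ⋃₀ 𝒜 = Set.univ)
    (α : ℕ → ℝ) (hanti : Antitone α) (hα_lim : Tendsto α atTop (nhds 0)) (hα0 : α 0 = 1)
    (hmix : AlphaMixing μ T 𝒜 α) :
    ∀ n : ℕ, 1 ≤ n → ∀ A : Set Ω, IsCylinderUnion T 𝒜 n A → ∀ k : ℕ, 1 ≤ k →
      (μ (A ∩ T^[k] ⁻¹' A)).toReal ≤ (μ A).toReal * deltaA μ T 𝒜 α A k := by
  intro n hn A hA k hk
  have hAm : MeasurableSet[cylinderSigma T 𝒜] A := by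
    obtain ⟨C, hC, hCc, rfl⟩ := hA
    exact MeasurableSet.sUnion hC
      (fun c hc => MeasurableSpace.measurableSet_generateFrom ⟨n, hCc c hc⟩)
  have hmem : deltaA μ T 𝒜 α A k ∈
      ((fun w => (μ (cylinderHull T 𝒜 w A)).toReal + α (k - w)) '' Set.Icc 1 k) :=
    Set.Nonempty.csInf_mem (Set.Nonempty.image _ ⟨1, le_refl 1, hk⟩)
      ((Set.finite_Icc 1 k).image _)
  obtain ⟨w, ⟨_, hwk⟩, hw⟩ := hmem
  rw [← hw]
  have hm := hmix w (k - w) _ A (isCylinderUnion_hull T 𝒜 hcnt w A) hAm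
  rw [Nat.add_sub_cancel' hwk] at hm
  have h1 := (abs_le.1 hm).2
  have h2 : (μ (A ∩ T^[k] ⁻¹' A)).toReal ≤
      (μ (cylinderHull T 𝒜 w A ∩ T^[k] ⁻¹' A)).toReal :=
    ENNReal.toReal_mono (measure_ne_top _ _)
      (measure_mono (Set.inter_subset_inter_left _ (subset_hull T 𝒜 hcov w A)))
  simp only
  linarith
end

section
/- A probability measure ν on ℕ₀ is the Poisson distribution with parameter t (i.e. ν({k}) = e^{−t} t^k/k! for all k ∈ ℕ₀) if and only if ∫_{ℕ₀} ( t·f(k+1) − k·f(k) ) dν(k) = 0 for every bounded function f : ℕ₀ → ℝ. -/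
open MeasureTheory Filter Set

/-- The Poisson mass function with parameter `t`: `e^{-t} t^k / k!`. -/
noncomputable def poissonMass (t : ℝ) (k : ℕ) : ℝ := Real.exp (-t) * t ^ k / (k.factorial : ℝ)

/-- `μ₀(h) = Σ_{i=0}^∞ h(i) e^{-t} t^i / i!`, the mean of `h` under the Poisson
distribution with parameter `t`. -/
noncomputable def poissonMean (t : ℝ) (h : ℕ → ℝ) : ℝ := ∑' i : ℕ, h i * poissonMass t i

/-- The Stein solution associated with `h`: `f(0) = 0` and
`f(k) = ((k−1)!/t^k) Σ_{i=0}^{k−1} (h(i) − μ₀(h)) t^i/i!` for `k ≥ 1`. -/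
noncomputable def steinSol (t : ℝ) (h : ℕ → ℝ) : ℕ → ℝ
  | 0 => 0
  | k + 1 => ((k.factorial : ℝ) / t ^ (k + 1)) *
      ∑ i ∈ Finset.range (k + 1), (h i - poissonMean t h) * t ^ i / (i.factorial : ℝ)

lemma poissonMass_succ (t : ℝ) (k : ℕ) :
    ((k : ℝ) + 1) * poissonMass t (k + 1) = t * poissonMass t k := by
  unfold poissonMass
  have : (k.factorial : ℝ) ≠ 0 := by positivity
  have : (k : ℝ) + 1 ≠ 0 := by positivity
  rw [Nat.factorial_succ]
  push_cast
  field_simp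
  ring

lemma hasSum_poissonMass (t : ℝ) (ht : 0 < t) : HasSum (poissonMass t) 1 :=
  ProbabilityTheory.hasSum_one_poissonMeasure ⟨t, ht.le⟩

lemma stein_sum_zero (t : ℝ) (ht : 0 < t) (f : ℕ → ℝ) (C : ℝ) (hC : ∀ k, |f k| ≤ C) :
    ∑' k : ℕ, poissonMass t k * (t * f (k + 1) - (k : ℝ) * f k) = 0 := by
  have hnn : ∀ k, 0 ≤ poissonMass t k := fun k => by unfold poissonMass; positivity
  let g : ℕ → ℝ := fun k => k * f k * poissonMass t k
  have hg1 : ∀ k, g (k + 1) = t * f (k + 1) * poissonMass t k := by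
    intro k
    have := poissonMass_succ t k
    simp only [g]
    push_cast
    linear_combination f (k + 1) * this
  have hs1 : Summable (fun k => g (k + 1)) := by
    refine Summable.of_norm_bounded (((hasSum_poissonMass t ht).summable).mul_left (t * C)) ?_
    intro k
    rw [hg1, Real.norm_eq_abs, abs_mul, abs_mul, abs_of_pos ht, abs_of_nonneg (hnn k)]
    have := hnn k
    gcongr
    exact hC _
  have hs : Summable g := (summable_nat_add_iff 1).1 hs1
  have h0 := hs.tsum_eq_zero_add
  have hg0 : g 0 = 0 := by simp [g]
  have : ∀ k : ℕ, poissonMass t k * (t * f (k + 1) - (k : ℝ) * f k) = g (k + 1) - g k := by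
    intro k
    rw [hg1]
    simp only [g]
    ring
  simp_rw [this]
  rw [hs1.tsum_sub hs, h0, hg0]
  ring

/-- A probability measure `ν` on `ℕ₀` is the Poisson distribution with
parameter `t` (i.e. `ν({k}) = e^{−t} t^k/k!` for all `k`) if and only if
`∫ (t·f(k+1) − k·f(k)) dν(k) = 0` for every bounded `f : ℕ₀ → ℝ`. -/
theorem poisson_iff_stein_operator_integral_zero
    (t : ℝ) (ht : 0 < t) (ν : Measure ℕ) [IsProbabilityMeasure ν] :
    (∀ k : ℕ, ν {k} = ENNReal.ofReal (poissonMass t k)) ↔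
      (∀ f : ℕ → ℝ, (∃ C : ℝ, ∀ k : ℕ, |f k| ≤ C) →
        ∫ k : ℕ, (t * f (k + 1) - (k : ℝ) * f k) ∂ν = 0) := by
  constructor
  · rintro h f ⟨C, hC⟩
    obtain ⟨r, rfl⟩ : ∃ r : NNReal, (r : ℝ) = t := ⟨t.toNNReal, Real.coe_toNNReal t ht.le⟩
    have hν : ν = ProbabilityTheory.poissonMeasure r := by
      refine Measure.ext_of_singleton fun k => ?_
      rw [h, ProbabilityTheory.poissonMeasure_singleton]
      rfl
    rw [hν, ProbabilityTheory.integral_poissonMeasure]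
    exact stein_sum_zero r ht f C hC
  · intro h
    have rec1 : ∀ j : ℕ, ((j : ℝ) + 1) * ν.real {j + 1} = t * ν.real {j} := by
      intro j
      have h1 := h (fun k => if k = j + 1 then 1 else 0) ⟨1, fun k => by
        split_ifs <;> simp⟩
      have h2 : (fun k : ℕ => t * (if k + 1 = j + 1 then (1 : ℝ) else 0)
          - (k : ℝ) * (if k = j + 1 then (1 : ℝ) else 0)) =
          fun k => ({j} : Set ℕ).indicator (fun _ => t) k
            - ({j + 1} : Set ℕ).indicator (fun _ => (j : ℝ) + 1) k := by
        funext k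
        by_cases a : k = j
        · subst a; simp
        · by_cases b : k = j + 1
          · subst b; simp
          · simp [a, b]
      rw [h2, integral_sub ((integrable_const _).indicator (measurableSet_singleton _))
        ((integrable_const _).indicator (measurableSet_singleton _)),
        integral_indicator_const _ (measurableSet_singleton _),
        integral_indicator_const _ (measurableSet_singleton _)] at h1
      simp only [smul_eq_mul] at h1
      linarith
    have key : ∀ k : ℕ, ν.real {k} = (ν.real {0} * Real.exp t) * poissonMass t k := by
      intro k
      induction k with
      | zero => simp [poissonMass, mul_assoc, ← Real.exp_add]
      | succ j ih =>
        have h1 := rec1 j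
        have h2 := poissonMass_succ t j
        have h3 : (j : ℝ) + 1 ≠ 0 := by positivity
        apply mul_left_cancel₀ h3
        rw [h1, ih]
        linear_combination (-(ν.real {0} * Real.exp t)) * h2
    have hsum : ∑' k : ℕ, ν.real {k} = 1 := by
      have := integral_countable (μ := ν) (f := fun _ : ℕ => (1 : ℝ)) (integrable_const _)
      simpa using this.symm
    have hc : ν.real {0} * Real.exp t = 1 := by
      rw [tsum_congr key] at hsum
      rw [tsum_mul_left, (hasSum_poissonMass t ht).tsum_eq, mul_one] at hsum
      exact hsum
    intro k
    have := key k
    rw [hc, one_mul] at this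
    rw [← this, ofReal_measureReal]
end

section
/- Let t > 0, let E ⊆ ℕ₀, and let f = f_{χ_E} be the Stein solution associated with the indicator function h = χ_E. Then |f(k)| ≤ 1 for every k ≥ 1 with k ≤ t, and |f(k)| ≤ (2 + t)/k for every k > t. -/
open MeasureTheory Filter Set

theorem aux_succ (t : ℝ) (n : ℕ) :
    t ^ (n + 1) / ((n + 1).factorial : ℝ) = t ^ n / (n.factorial : ℝ) * (t / (n + 1)) := by
  have h1 : (n.factorial : ℝ) ≠ 0 := by positivity
  have h2 : (n + 1 : ℝ) ≠ 0 := by positivity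
  rw [Nat.factorial_succ, pow_succ]
  push_cast
  field_simp

theorem aux_mono (t : ℝ) (ht : 0 < t) (m : ℕ) (hm : (m : ℝ) ≤ t) :
    ∀ i, i ≤ m → t ^ i / (i.factorial : ℝ) ≤ t ^ m / (m.factorial : ℝ) := by
  induction m with
  | zero =>
    intro i hi
    obtain rfl : i = 0 := by omega
    exact le_rfl
  | succ n ih =>
    intro i hi
    push_cast at hm
    rcases Nat.lt_or_ge n i with h | h
    · obtain rfl : i = n + 1 := by omega
      exact le_rfl
    · refine (ih (by linarith) i h).trans ?_
      rw [aux_succ]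
      apply le_mul_of_one_le_right (by positivity)
      rw [le_div_iff₀ (by positivity)]
      linarith

theorem aux_geom (t : ℝ) (ht : 0 < t) (k : ℕ) (j : ℕ) :
    t ^ (j + k) / ((j + k).factorial : ℝ) ≤ t ^ k / (k.factorial : ℝ) * (t / (k + 1)) ^ j := by
  induction j with
  | zero => simp
  | succ n ih =>
    rw [show n + 1 + k = (n + k) + 1 by ring, aux_succ, pow_succ, ← mul_assoc]
    apply mul_le_mul ih _ (by positivity) (by positivity)
    apply div_le_div_of_nonneg_left ht.le (by positivity)
    push_cast
    have : (0 : ℝ) ≤ n := by positivity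
    linarith

theorem aux_hasSum (t : ℝ) : HasSum (fun i : ℕ => t ^ i / (i.factorial : ℝ)) (Real.exp t) := by
  rw [Real.exp_eq_exp_ℝ]
  exact NormedSpace.expSeries_div_hasSum_exp t

theorem aux_mean (t : ℝ) (ht : 0 < t) (h : ℕ → ℝ) (h0 : ∀ i, 0 ≤ h i) (h1 : ∀ i, h i ≤ 1) :
    0 ≤ poissonMean t h ∧ poissonMean t h ≤ 1 ∧
    HasSum (fun i : ℕ => (h i - poissonMean t h) * t ^ i / (i.factorial : ℝ)) 0 := by
  have hs := aux_hasSum t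
  have hm : HasSum (poissonMass t) 1 := by
    have := hs.mul_left (Real.exp (-t))
    rw [← Real.exp_add, neg_add_cancel, Real.exp_zero] at this
    have he : poissonMass t = fun i : ℕ => Real.exp (-t) * (t ^ i / (i.factorial : ℝ)) := by
      funext i
      unfold poissonMass
      ring
    rw [he]
    exact this
  have hp : ∀ i, 0 ≤ poissonMass t i := fun i => by unfold poissonMass; positivity
  have hle : ∀ i, h i * poissonMass t i ≤ poissonMass t i :=
    fun i => mul_le_of_le_one_left (hp i) (h1 i)
  have hsum : Summable (fun i => h i * poissonMass t i) :=
    Summable.of_nonneg_of_le (fun i => mul_nonneg (h0 i) (hp i)) hle hm.summable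
  refine ⟨tsum_nonneg fun i => mul_nonneg (h0 i) (hp i), ?_, ?_⟩
  · exact hasSum_le hle hsum.hasSum hm
  · have h2 := (hsum.hasSum.sub (hm.mul_left (poissonMean t h))).mul_left (Real.exp t)
    have h3 : Real.exp t * ((∑' i, h i * poissonMass t i) - poissonMean t h * 1) = 0 := by
      unfold poissonMean
      ring
    rw [h3] at h2
    refine Eq.mp (congrArg (fun g : ℕ → ℝ => HasSum g 0) (funext fun i => ?_)) h2
    symm
    have h4 : Real.exp t * Real.exp (-t) = 1 := by
      rw [← Real.exp_add, add_neg_cancel, Real.exp_zero]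
    unfold poissonMass
    linear_combination (-(h i - poissonMean t h) * t ^ i / (i.factorial : ℝ)) * h4

/-- Let `t > 0`, `E ⊆ ℕ₀`, and let `f = f_{χ_E}` be the Stein solution for the
indicator `h = χ_E`. Then `|f(k)| ≤ 1` for every `k ≥ 1` with `k ≤ t`, and
`|f(k)| ≤ (2 + t)/k` for every `k > t`. -/
theorem steinSol_indicator_bounds
    (t : ℝ) (ht : 0 < t) (E : Set ℕ) :
    (∀ k : ℕ, 1 ≤ k → (k : ℝ) ≤ t →
      |steinSol t (E.indicator fun _ => (1 : ℝ)) k| ≤ 1) ∧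
    (∀ k : ℕ, t < (k : ℝ) →
      |steinSol t (E.indicator fun _ => (1 : ℝ)) k| ≤ (2 + t) / k) := by
  have h0 : ∀ i, 0 ≤ E.indicator (fun _ => (1 : ℝ)) i :=
    fun i => Set.indicator_nonneg (fun _ _ => zero_le_one) i
  have h1 : ∀ i, E.indicator (fun _ => (1 : ℝ)) i ≤ 1 :=
    fun i => Set.indicator_le_self' (fun _ _ => zero_le_one) i
  generalize E.indicator (fun _ => (1 : ℝ)) = h at h0 h1 ⊢
  obtain ⟨m0, m1, hs⟩ := aux_mean t ht h h0 h1
  have hb : ∀ i : ℕ, |(h i - poissonMean t h) * t ^ i / (i.factorial : ℝ)|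
      ≤ t ^ i / (i.factorial : ℝ) := by
    intro i
    have hp : 0 ≤ t ^ i / (i.factorial : ℝ) := by positivity
    rw [mul_div_assoc, abs_mul, abs_of_nonneg hp]
    apply mul_le_of_le_one_left hp
    rw [abs_le]
    constructor <;> linarith [h0 i, h1 i]
  constructor
  · intro k hk hkt
    obtain ⟨m, rfl⟩ : ∃ m, k = m + 1 := ⟨k - 1, by omega⟩
    push_cast at hkt
    simp only [steinSol]
    have hc : 0 < (m.factorial : ℝ) / t ^ (m + 1) := by positivity
    rw [abs_mul, abs_of_pos hc]
    have hS : |∑ i ∈ Finset.range (m + 1), (h i - poissonMean t h) * t ^ i / (i.factorial : ℝ)|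
        ≤ (m + 1) * (t ^ m / (m.factorial : ℝ)) := by
      refine (Finset.abs_sum_le_sum_abs _ _).trans ?_
      refine (Finset.sum_le_card_nsmul _ _ (t ^ m / (m.factorial : ℝ)) ?_).trans ?_
      · intro i hi
        exact (hb i).trans (aux_mono t ht m (by linarith) i (by
          have := Finset.mem_range.1 hi
          omega))
      · simp
    refine (mul_le_mul_of_nonneg_left hS hc.le).trans ?_
    have h3 : (m.factorial : ℝ) / t ^ (m + 1) * ((m + 1) * (t ^ m / (m.factorial : ℝ)))
        = (m + 1) / t := by
      have : (m.factorial : ℝ) ≠ 0 := by positivity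
      rw [pow_succ]
      field_simp
    rw [h3, div_le_one ht]
    exact hkt
  · intro k hkt
    rcases k with _ | m
    · simp at hkt
      linarith
    simp only [steinSol]
    have hc : 0 < (m.factorial : ℝ) / t ^ (m + 1) := by positivity
    rw [abs_mul, abs_of_pos hc]
    have h2 := hs.summable.sum_add_tsum_nat_add (m + 1)
    rw [hs.tsum_eq] at h2
    rw [eq_neg_of_add_eq_zero_left h2, abs_neg]
    have hr0 : 0 ≤ t / (((m + 1 : ℕ) : ℝ) + 1) := by positivity
    have hr1 : t / (((m + 1 : ℕ) : ℝ) + 1) < 1 := by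
      rw [div_lt_one (by positivity)]
      linarith
    have hg := (hasSum_geometric_of_lt_one hr0 hr1).mul_left
      (t ^ (m + 1) / ((m + 1).factorial : ℝ))
    have hS := tsum_of_norm_bounded (f := fun j : ℕ =>
      (h (j + (m + 1)) - poissonMean t h) * t ^ (j + (m + 1)) / ((j + (m + 1)).factorial : ℝ)) hg
      (fun j => (hb (j + (m + 1))).trans (aux_geom t ht (m + 1) j))
    rw [Real.norm_eq_abs] at hS
    refine (mul_le_mul_of_nonneg_left hS hc.le).trans ?_
    rw [Nat.factorial_succ]
    push_cast at hkt ⊢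
    have hf : (m.factorial : ℝ) ≠ 0 := by positivity
    have hm : (0 : ℝ) < m + 1 := by positivity
    have hd : (0 : ℝ) < m + 1 + 1 - t := by linarith
    have h3 : (m.factorial : ℝ) / t ^ (m + 1) *
        (t ^ (m + 1) / ((m + 1) * (m.factorial : ℝ)) * (1 - t / ((m : ℝ) + 1 + 1))⁻¹)
        = ((m + 1 + 1) / (m + 1 + 1 - t)) / (m + 1) := by
      have h4 : 1 - t / ((m : ℝ) + 1 + 1) = (m + 1 + 1 - t) / (m + 1 + 1) := by
        field_simp
      rw [h4, inv_div]
      have := hd.ne'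
      field_simp
    rw [h3]
    apply div_le_div_of_nonneg_right _ hm.le
    rw [div_le_iff₀ hd]
    nlinarith [mul_nonneg ht.le (sub_nonneg.2 hkt.le)]
end

section
/- Let t > 0, let E ⊆ ℕ₀, and let f = f_{χ_E} be the Stein solution associated with the indicator function h = χ_E. Then for every m ∈ ℕ: Σ_{i=1}^m |f(i)| ≤ m if m ≤ t, and Σ_{i=1}^m |f(i)| ≤ t + (2 + t)·log(m/t) if m > t. -/
open MeasureTheory Filter Set

lemma pm_pos (t : ℝ) (ht : 0 < t) (k : ℕ) : 0 < poissonMass t k := by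
  unfold poissonMass; positivity

lemma pm_succ (t : ℝ) (k : ℕ) :
    poissonMass t (k + 1) * ((k : ℝ) + 1) = t * poissonMass t k := by
  unfold poissonMass
  rw [Nat.factorial_succ]
  push_cast
  field_simp
  ring

lemma pm_hasSum (t : ℝ) : HasSum (poissonMass t) 1 := by
  have h : HasSum (fun n : ℕ => t ^ n / (n.factorial : ℝ)) (Real.exp t) := by
    rw [Real.exp_eq_exp_ℝ]
    exact NormedSpace.expSeries_div_hasSum_exp t
  have h2 := h.mul_left (Real.exp (-t))
  rw [← Real.exp_add, neg_add_cancel, Real.exp_zero] at h2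
  refine h2.congr_fun ?_ |> id
  intro n
  unfold poissonMass
  ring

lemma pm_geom (t : ℝ) (ht : 0 < t) (K j : ℕ) :
    poissonMass t (j + K) ≤ poissonMass t K * (t / ((K : ℝ) + 1)) ^ j := by
  induction j with
  | zero => simp
  | succ j ih =>
    have h := pm_succ t (j + K)
    have hp := pm_pos t ht (j + K)
    have e : poissonMass t (j + 1 + K) = poissonMass t (j + K) * (t / ((j + K : ℕ) + 1 : ℝ)) := by
      rw [show j + 1 + K = j + K + 1 by ring]
      field_simp
      linarith
    rw [e, pow_succ, ← mul_assoc]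
    apply mul_le_mul ih _ (by positivity) (by have := pm_pos t ht K; positivity)
    apply div_le_div_of_nonneg_left ht.le (by positivity)
    push_cast
    have : (0 : ℝ) ≤ j := by positivity
    linarith


lemma pm_tail (t : ℝ) (ht : 0 < t) (k : ℕ) (hk : t < (k : ℝ) + 2) :
    (∑' j, poissonMass t (j + (k + 1))) * (((k : ℝ) + 1) * ((k : ℝ) + 2 - t))
      ≤ (t * poissonMass t k) * ((k : ℝ) + 2) := by
  set r : ℝ := t / (((k + 1 : ℕ) : ℝ) + 1) with hr
  have hr0 : 0 ≤ r := by positivity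
  have hr1 : r < 1 := by
    rw [hr, div_lt_one (by positivity)]; push_cast; linarith
  have hg := (hasSum_geometric_of_lt_one hr0 hr1).mul_left (poissonMass t (k + 1))
  have hs : Summable (fun j => poissonMass t (j + (k + 1))) :=
    (summable_nat_add_iff (k + 1)).2 (pm_hasSum t).summable
  have h1 : (∑' j, poissonMass t (j + (k + 1))) ≤ poissonMass t (k + 1) * (1 - r)⁻¹ := by
    rw [← hg.tsum_eq]
    exact hs.tsum_le_tsum (fun j => pm_geom t ht (k + 1) j) hg.summable
  have h2 : (1 - r)⁻¹ = ((k : ℝ) + 2) / ((k : ℝ) + 2 - t) := by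
    have : (k : ℝ) + 2 - t ≠ 0 := by linarith
    have e : 1 - r = ((k : ℝ) + 2 - t) / ((k : ℝ) + 2) := by
      rw [hr]; push_cast; field_simp; ring
    rw [e, inv_div]
  rw [h2] at h1
  have hd : 0 < (k : ℝ) + 2 - t := by linarith
  calc _ ≤ (poissonMass t (k + 1) * (((k : ℝ) + 2) / ((k : ℝ) + 2 - t)))
        * (((k : ℝ) + 1) * ((k : ℝ) + 2 - t)) :=
        mul_le_mul_of_nonneg_right h1 (by positivity)
    _ = (poissonMass t (k + 1) * ((k : ℝ) + 1)) * ((k : ℝ) + 2) := by field_simp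
    _ = _ := by rw [pm_succ]

lemma pm_mono (t : ℝ) (ht : 0 < t) (k : ℕ) (hk : (k : ℝ) ≤ t) (i d : ℕ) (h : i + d = k) :
    poissonMass t i ≤ poissonMass t k := by
  induction d generalizing i with
  | zero => simp at h; rw [h]
  | succ d ih =>
    refine le_trans ?_ (ih (i + 1) (by omega))
    have e := pm_succ t i
    have hp := pm_pos t ht i
    have hi : (i : ℝ) + 1 ≤ t := by
      refine le_trans ?_ hk
      exact_mod_cast (by omega : i + 1 ≤ k)
    have h0 : (0 : ℝ) < (i : ℝ) + 1 := by positivity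
    nlinarith

lemma pm_head (t : ℝ) (ht : 0 < t) (k : ℕ) (hk : (k : ℝ) ≤ t) :
    (∑ i ∈ Finset.range (k + 1), poissonMass t i) * t ≤ ((k : ℝ) + 1) * (t * poissonMass t k) := by
  have : (∑ i ∈ Finset.range (k + 1), poissonMass t i) ≤ ((k : ℝ) + 1) * poissonMass t k := by
    have := Finset.sum_le_card_nsmul (Finset.range (k + 1)) (poissonMass t) (poissonMass t k)
      (fun i hi => pm_mono t ht k hk i (k - i) (by
        have := Finset.mem_range.1 hi
        omega))
    simpa using this
  nlinarith

set_option maxHeartbeats 2000000 in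
lemma stein_key (t : ℝ) (ht : 0 < t) (E : Set ℕ) (k : ℕ) :
    |steinSol t (E.indicator fun _ => (1 : ℝ)) (k + 1)| * (t * poissonMass t k) ≤
      (∑ i ∈ Finset.range (k + 1), poissonMass t i) * ∑' j, poissonMass t (j + (k + 1)) := by
  generalize hh : (E.indicator fun _ => (1 : ℝ)) = h
  have h0 : ∀ i, 0 ≤ h i := fun i => by
    rw [← hh]; exact Set.indicator_nonneg (fun _ _ => zero_le_one) i
  have h1 : ∀ i, h i ≤ 1 := fun i =>
    by rw [← hh]; exact Set.indicator_le_self' (f := fun _ => (1 : ℝ)) (fun _ _ => zero_le_one) i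
  have hp := fun i => (pm_pos t ht i).le
  have hle : ∀ i, h i * poissonMass t i ≤ poissonMass t i := fun i =>
    mul_le_of_le_one_left (hp i) (h1 i)
  have hs := (pm_hasSum t).summable
  have hhs : Summable (fun i => h i * poissonMass t i) :=
    Summable.of_nonneg_of_le (fun i => mul_nonneg (h0 i) (hp i)) hle hs
  have hM := hhs.sum_add_tsum_nat_add (k + 1)
  have h1' := hs.sum_add_tsum_nat_add (k + 1)
  rw [(pm_hasSum t).tsum_eq] at h1'
  have hMd : (∑' i, h i * poissonMass t i) = poissonMean t h := by unfold poissonMean; rfl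
  rw [hMd] at hM
  set A := ∑ i ∈ Finset.range (k + 1), h i * poissonMass t i with hA
  set B := ∑' j, h (j + (k + 1)) * poissonMass t (j + (k + 1)) with hB
  set u := ∑ i ∈ Finset.range (k + 1), poissonMass t i with hu
  set v := ∑' j, poissonMass t (j + (k + 1)) with hv
  have hA0 : 0 ≤ A := Finset.sum_nonneg fun i _ => mul_nonneg (h0 i) (hp i)
  have hAu : A ≤ u := Finset.sum_le_sum fun i _ => hle i
  have hB0 : 0 ≤ B := tsum_nonneg fun i => mul_nonneg (h0 _) (hp _)
  have hBv : B ≤ v := Summable.tsum_le_tsum (fun j => hle _)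
    ((summable_nat_add_iff (k + 1)).2 hhs) ((summable_nat_add_iff (k + 1)).2 hs)
  have hf : steinSol t h (k + 1) * (t * poissonMass t k) = A - poissonMean t h * u := by
    rw [hA, hu, Finset.mul_sum, ← Finset.sum_sub_distrib]
    unfold steinSol
    rw [mul_right_comm, Finset.mul_sum]
    apply Finset.sum_congr rfl
    intro i _
    unfold poissonMass
    field_simp
    ring
  have hq : 0 ≤ t * poissonMass t k := mul_nonneg ht.le (hp k)
  rw [← abs_of_nonneg hq, ← abs_mul, hf, ← hM]
  have hu1 : u = 1 - v := by linarith
  have e : A - (A + B) * u = A * v - B * u := by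
    have : A = A * (u + v) := by rw [h1', mul_one]
    linear_combination this
  have hu0 : 0 ≤ u := hA0.trans hAu
  have hv0 : 0 ≤ v := hB0.trans hBv
  rw [e, abs_le]
  constructor
  · nlinarith [mul_nonneg hA0 hv0, mul_le_mul_of_nonneg_right hBv hu0]
  · nlinarith [mul_nonneg hB0 hu0, mul_le_mul_of_nonneg_right hAu hv0]

lemma stein_bounds (t : ℝ) (ht : 0 < t) (E : Set ℕ) (k : ℕ) :
    |steinSol t (E.indicator fun _ => (1 : ℝ)) (k + 1)| ≤ 1 ∧
    |steinSol t (E.indicator fun _ => (1 : ℝ)) (k + 1)| * ((k : ℝ) + 1) ≤ 2 + t := by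
  have key := stein_key t ht E k
  have hq : 0 < t * poissonMass t k := mul_pos ht (pm_pos t ht k)
  have hT := pm_tail t ht k
  have hH := pm_head t ht k
  have h1' := (pm_hasSum t).summable.sum_add_tsum_nat_add (k + 1)
  rw [(pm_hasSum t).tsum_eq] at h1'
  have hu0 : 0 ≤ ∑ i ∈ Finset.range (k + 1), poissonMass t i :=
    Finset.sum_nonneg fun i _ => (pm_pos t ht i).le
  have hv0 : 0 ≤ ∑' j, poissonMass t (j + (k + 1)) := tsum_nonneg fun i => (pm_pos t ht _).le
  have hF : 0 ≤ |steinSol t (E.indicator fun _ => (1 : ℝ)) (k + 1)| := abs_nonneg _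
  generalize |steinSol t (E.indicator fun _ => (1 : ℝ)) (k + 1)| = F at *
  generalize ∑' j, poissonMass t (j + (k + 1)) = v at *
  generalize ∑ i ∈ Finset.range (k + 1), poissonMass t i = u at *
  generalize t * poissonMass t k = q at *
  have hk0 : (0 : ℝ) ≤ k := by positivity
  generalize (k : ℝ) = x at *
  have huv_v : u * v ≤ v := mul_le_of_le_one_left hv0 (by linarith)
  have huv_u : u * v ≤ u := mul_le_of_le_one_right hu0 (by linarith)
  have huv0 : 0 ≤ u * v := mul_nonneg hu0 hv0
  have hone : F ≤ 1 := by
    suffices u * v ≤ q by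
      by_contra hc
      push Not at hc
      nlinarith
    rcases le_total (x + 1) t with h | h
    · have := hH (by linarith)
      have : u ≤ q := by
        by_contra hc
        push Not at hc
        nlinarith
      linarith
    · have hT' := hT (by linarith)
      rcases le_total t x with h2 | h2
      · have : v ≤ q := by
          have h3 : v * ((x + 1) * 2) ≤ v * ((x + 1) * (x + 2 - t)) := by gcongr; linarith
          by_contra hc
          push Not at hc
          nlinarith
        linarith
      · have hH' := hH h2
        have a1 : u * (t / (x + 1)) ≤ q := by
          rw [← mul_div_assoc, div_le_iff₀ (by positivity)]; linarith
        have a2 : v * ((x + 1) * (x + 2 - t) / (x + 2)) ≤ q := by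
          rw [← mul_div_assoc, div_le_iff₀ (by positivity)]; linarith
        have a3 : 1 ≤ t / (x + 1) + (x + 1) * (x + 2 - t) / (x + 2) := by
          rw [div_add_div _ _ (by positivity) (by positivity), le_div_iff₀ (by positivity)]
          nlinarith [mul_nonneg hk0 (sub_nonneg.2 h), mul_nonneg hk0 (sub_nonneg.2 h2),
            mul_nonneg (mul_nonneg hk0 hk0) (sub_nonneg.2 h)]
        have b1 := mul_le_mul_of_nonneg_right a1 hv0
        have b2 := mul_le_mul_of_nonneg_right a2 hu0
        have b3 := mul_le_mul_of_nonneg_left a3 huv0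
        have b4 : q * v + q * u = q := by rw [← mul_add, add_comm, h1', mul_one]
        nlinarith
  refine ⟨hone, ?_⟩
  rcases le_total (x + 1) (2 + t) with h | h
  · nlinarith
  · have hT' := hT (by linarith)
    have hd : 0 < x + 2 - t := by linarith
    have c1 : F * q * ((x + 1) * (x + 2 - t)) ≤ q * (x + 2) := by
      refine le_trans ?_ hT'
      gcongr
      linarith
    have c2 : F * (x + 1) * (x + 2 - t) ≤ x + 2 := by
      refine le_of_mul_le_mul_left ?_ hq
      linarith
    have c3 : x + 2 ≤ (2 + t) * (x + 2 - t) := by nlinarith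
    exact le_of_mul_le_mul_right (c2.trans c3) hd

lemma one_sub_le_log (a b : ℝ) (ha : 0 < a) (hb : 0 < b) : 1 - a / b ≤ Real.log (b / a) := by
  have := Real.one_sub_inv_le_log_of_pos (div_pos hb ha)
  rwa [inv_div] at this

/-- Let `t > 0`, `E ⊆ ℕ₀`, and `f = f_{χ_E}` the Stein solution for `h = χ_E`.
Then for every `m ∈ ℕ`: `Σ_{i=1}^m |f(i)| ≤ m` if `m ≤ t`, and
`Σ_{i=1}^m |f(i)| ≤ t + (2 + t)·log(m/t)` if `m > t`. -/
theorem steinSol_indicator_sum_bounds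
    (t : ℝ) (ht : 0 < t) (E : Set ℕ) :
    ∀ m : ℕ,
      ((m : ℝ) ≤ t →
        ∑ i ∈ Finset.Icc 1 m, |steinSol t (E.indicator fun _ => (1 : ℝ)) i| ≤ (m : ℝ)) ∧
      (t < (m : ℝ) →
        ∑ i ∈ Finset.Icc 1 m, |steinSol t (E.indicator fun _ => (1 : ℝ)) i| ≤
          t + (2 + t) * Real.log ((m : ℝ) / t)) := by
  intro m
  induction m with
  | zero =>
    refine ⟨fun _ => by simp, fun h => ?_⟩
    simp at h
    linarith
  | succ k ih =>
    obtain ⟨hb1, hb2⟩ := stein_bounds t ht E k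
    rw [Finset.sum_Icc_succ_top (by omega)]
    have hk0 : (0 : ℝ) ≤ k := by positivity
    push_cast
    refine ⟨fun h => ?_, fun h => ?_⟩
    · have := ih.1 (by linarith)
      linarith
    · rcases le_or_gt (k : ℝ) t with h2 | h2
      · have h3 := ih.1 h2
        have h4 := one_sub_le_log t ((k : ℝ) + 1) ht (by linarith)
        have h5 : (2 + t) * (1 - t / ((k : ℝ) + 1)) ≤ (2 + t) * Real.log (((k : ℝ) + 1) / t) := by
          gcongr
        have h6 : (k : ℝ) + 1 - t ≤ (2 + t) * (1 - t / ((k : ℝ) + 1)) := by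
          have e : (2 + t) * (1 - t / ((k : ℝ) + 1))
              = (2 + t) * ((k : ℝ) + 1 - t) / ((k : ℝ) + 1) := by field_simp
          rw [e, le_div_iff₀ (by positivity)]
          nlinarith
        linarith
      · have h3 := ih.2 h2
        have hkp : (0 : ℝ) < k := by linarith
        have h4 := one_sub_le_log (k : ℝ) ((k : ℝ) + 1) hkp (by linarith)
        have h5 : (2 + t) * (1 - (k : ℝ) / ((k : ℝ) + 1))
            ≤ (2 + t) * Real.log (((k : ℝ) + 1) / k) := by
          gcongr
        have e : (2 + t) * (1 - (k : ℝ) / ((k : ℝ) + 1)) = (2 + t) / ((k : ℝ) + 1) := by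
          field_simp
          ring
        rw [← le_div_iff₀ (by positivity)] at hb2
        have h6 : Real.log (((k : ℝ) + 1) / t)
            = Real.log ((k : ℝ) / t) + Real.log (((k : ℝ) + 1) / k) := by
          rw [← Real.log_mul (by positivity) (by positivity)]
          congr 1
          field_simp
        rw [h6]
        linarith
end

section
/- Let (Ω, ℱ, μ) be a probability space, T : Ω → Ω a measurable map preserving μ, and A ∈ ℱ. Then for all integers i ≥ Δ ≥ 1: μ( T^{−i}A ∩ ⋃_{k=1}^{Δ} T^{−(i−k)}A ) = μ( T^{−i}A ∩ ⋃_{k=1}^{Δ} T^{−(i+k)}A ). -/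
open MeasureTheory Filter Set

/-- For a measure-preserving `T` on a probability space and `A ∈ ℱ`, for all
integers `i ≥ Δ ≥ 1`:
`μ(T^{−i}A ∩ ⋃_{k=1}^{Δ} T^{−(i−k)}A) = μ(T^{−i}A ∩ ⋃_{k=1}^{Δ} T^{−(i+k)}A)`. -/
theorem measure_inter_union_preimages_symm
    {Ω : Type*} [MeasurableSpace Ω] (μ : Measure Ω) [IsProbabilityMeasure μ]
    (T : Ω → Ω) (hT : MeasurePreserving T μ μ)
    (A : Set Ω) (hA : MeasurableSet A) :
    ∀ i Δ : ℕ, 1 ≤ Δ → Δ ≤ i →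
      μ (T^[i] ⁻¹' A ∩ ⋃ k ∈ Finset.Icc 1 Δ, T^[i - k] ⁻¹' A) =
        μ (T^[i] ⁻¹' A ∩ ⋃ k ∈ Finset.Icc 1 Δ, T^[i + k] ⁻¹' A) := by
  intro i Δ h1 h2
  have hm : ∀ n, MeasurableSet (T^[n] ⁻¹' A) := fun n => (hT.iterate n).measurable hA
  -- the union of `n` consecutive preimages, and its shift invariance
  let M : ℕ → Set Ω := fun n => ⋃ k ∈ Finset.range n, T^[k] ⁻¹' A
  have hM : ∀ n, MeasurableSet (M n) := fun n =>
    Finset.measurableSet_biUnion _ (fun k _ => hm k)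
  have hS : ∀ a n, μ (T^[a] ⁻¹' M n) = μ (M n) := fun a n =>
    (hT.iterate a).measure_preimage (hM n).nullMeasurableSet
  have hmem : ∀ a n x, x ∈ T^[a] ⁻¹' M n ↔ ∃ k, k < n ∧ T^[k + a] x ∈ A := by
    intro a n x
    simp [M, Function.iterate_add_apply]
  have e1 : (⋃ k ∈ Finset.Icc 1 Δ, T^[i - k] ⁻¹' A) = T^[i - Δ] ⁻¹' M Δ := by
    ext x
    rw [hmem]
    simp only [mem_iUnion, Finset.mem_Icc, mem_preimage, exists_prop]
    constructor
    · rintro ⟨k, hk, hx⟩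
      refine ⟨Δ - k, by omega, ?_⟩
      rwa [show Δ - k + (i - Δ) = i - k by omega]
    · rintro ⟨k, hk, hx⟩
      refine ⟨Δ - k, by omega, ?_⟩
      rwa [show i - (Δ - k) = k + (i - Δ) by omega]
  have e2 : (⋃ k ∈ Finset.Icc 1 Δ, T^[i + k] ⁻¹' A) = T^[i + 1] ⁻¹' M Δ := by
    ext x
    rw [hmem]
    simp only [mem_iUnion, Finset.mem_Icc, mem_preimage, exists_prop]
    constructor
    · rintro ⟨k, hk, hx⟩
      refine ⟨k - 1, by omega, ?_⟩
      rwa [show k - 1 + (i + 1) = i + k by omega]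
    · rintro ⟨k, hk, hx⟩
      refine ⟨k + 1, by omega, ?_⟩
      rwa [show i + (k + 1) = k + (i + 1) by omega]
  have u1 : T^[i] ⁻¹' A ∪ T^[i - Δ] ⁻¹' M Δ = T^[i - Δ] ⁻¹' M (Δ + 1) := by
    ext x
    rw [mem_union, hmem, hmem, mem_preimage]
    constructor
    · rintro (hx | ⟨k, hk, hx⟩)
      · refine ⟨Δ, by omega, ?_⟩
        rwa [show Δ + (i - Δ) = i by omega]
      · exact ⟨k, by omega, hx⟩
    · rintro ⟨k, hk, hx⟩
      by_cases hkΔ : k = Δ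
      · left
        rwa [hkΔ, show Δ + (i - Δ) = i by omega] at hx
      · exact Or.inr ⟨k, by omega, hx⟩
  have u2 : T^[i] ⁻¹' A ∪ T^[i + 1] ⁻¹' M Δ = T^[i] ⁻¹' M (Δ + 1) := by
    ext x
    rw [mem_union, hmem, hmem, mem_preimage]
    constructor
    · rintro (hx | ⟨k, hk, hx⟩)
      · refine ⟨0, by omega, ?_⟩
        rwa [Nat.zero_add]
      · refine ⟨k + 1, by omega, ?_⟩
        rwa [show k + 1 + i = k + (i + 1) by omega]
    · rintro ⟨k, hk, hx⟩
      by_cases hk0 : k = 0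
      · left
        rwa [hk0, Nat.zero_add] at hx
      · refine Or.inr ⟨k - 1, by omega, ?_⟩
        rwa [show k - 1 + (i + 1) = k + i by omega]
  rw [e1, e2]
  have q1 := measure_union_add_inter' (μ := μ) (hm i) (T^[i - Δ] ⁻¹' M Δ)
  have q2 := measure_union_add_inter' (μ := μ) (hm i) (T^[i + 1] ⁻¹' M Δ)
  rw [u1, hS, hS] at q1
  rw [u2, hS, hS, ← q1] at q2
  exact ((ENNReal.add_right_inj (measure_ne_top μ _)).1 q2).symm
end
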